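/- arXiv:2401.00594 — 4 statements merged into one kernel-verified Lean document; each statement's English description precedes it below -/
import Mathlib

section
/- Suppose t* > 0 is the greatest element of the set {t ∈ ℝ : ∃ w, ∃ e ∈ T, P_tot(w) ≤ P and t = f(w,e)}, where P > 0 is a given power budget, and suppose P* is the least element of the set {p ∈ ℝ : ∃ w, ∃ e ∈ T, SINR_u(w,e) ≥ t*·γ_u for all u ∈ U and p = P_tot(w)}. Then P* = P. (This is the identity P = P_o(S_o(γ,P)·γ) of Proposition 1: the RIS-assisted multicast QoS power-minimization problem and the RIS-assisted max-min-fair problem are inverse problems.) -/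
noncomputable def effChan {N M : ℕ} {U : Type*}
    (hd : U → EuclideanSpace ℂ (Fin N)) (Gc : U → Matrix (Fin N) (Fin M) ℂ)
    (u : U) (e : EuclideanSpace ℂ (Fin M)) : EuclideanSpace ℂ (Fin N) :=
  hd u + ((WithLp.equiv 2 (Fin N → ℂ)).symm (fun n => ∑ m, Gc u n m * e m))

noncomputable def SINR {N M G : ℕ} {U : Type*} (g : U → Fin G)
    (hd : U → EuclideanSpace ℂ (Fin N)) (Gc : U → Matrix (Fin N) (Fin M) ℂ)
    (σ : ℝ) (w : Fin G → EuclideanSpace ℂ (Fin N))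
    (e : EuclideanSpace ℂ (Fin M)) (u : U) : ℝ :=
  ‖(inner ℂ (w (g u)) (effChan hd Gc u e) : ℂ)‖ ^ 2 /
    ((∑ j ∈ Finset.univ \ {g u}, ‖(inner ℂ (w j) (effChan hd Gc u e) : ℂ)‖ ^ 2) + σ ^ 2)

noncomputable def Ptot {N G : ℕ} (w : Fin G → EuclideanSpace ℂ (Fin N)) : ℝ :=
  ∑ i, ‖w i‖ ^ 2

noncomputable def minW {N M G : ℕ} {U : Type*} [Fintype U] [Nonempty U] (g : U → Fin G)
    (hd : U → EuclideanSpace ℂ (Fin N)) (Gc : U → Matrix (Fin N) (Fin M) ℂ)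
    (σ : ℝ) (γ : U → ℝ) (w : Fin G → EuclideanSpace ℂ (Fin N))
    (e : EuclideanSpace ℂ (Fin M)) : ℝ :=
  Finset.univ.inf' Finset.univ_nonempty (fun u => SINR g hd Gc σ w e u / γ u)

theorem SINR_smul {N M G : ℕ} {U : Type*} (g : U → Fin G)
    (hd : U → EuclideanSpace ℂ (Fin N)) (Gc : U → Matrix (Fin N) (Fin M) ℂ)
    (σ : ℝ) (hσ : 0 < σ ^ 2) (w : Fin G → EuclideanSpace ℂ (Fin N))
    (e : EuclideanSpace ℂ (Fin M)) (u : U) (c : ℝ) (hc : 1 < c ^ 2)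
    (hS : 0 < SINR g hd Gc σ w e u) :
    SINR g hd Gc σ w e u < SINR g hd Gc σ (fun i => (c : ℂ) • w i) e u := by
  have key : ∀ j, ‖(inner ℂ ((c : ℂ) • w j) (effChan hd Gc u e) : ℂ)‖ ^ 2
      = c ^ 2 * ‖(inner ℂ (w j) (effChan hd Gc u e) : ℂ)‖ ^ 2 := by
    intro j
    rw [inner_smul_left, norm_mul, mul_pow]
    simp
  unfold SINR at hS ⊢
  simp only [key]
  rw [← Finset.mul_sum]
  have hI : 0 ≤ ∑ j ∈ Finset.univ \ {g u}, ‖(inner ℂ (w j) (effChan hd Gc u e) : ℂ)‖ ^ 2 :=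
    Finset.sum_nonneg fun _ _ => by positivity
  generalize (∑ j ∈ Finset.univ \ {g u}, ‖(inner ℂ (w j) (effChan hd Gc u e) : ℂ)‖ ^ 2) = I at *
  generalize ‖(inner ℂ (w (g u)) (effChan hd Gc u e) : ℂ)‖ ^ 2 = S at *
  have hD : 0 < I + σ ^ 2 := by linarith
  have hS' : 0 < S := by
    have := mul_pos hS hD
    rwa [div_mul_cancel₀ _ hD.ne'] at this
  have hD' : 0 < c ^ 2 * I + σ ^ 2 := by positivity
  rw [div_lt_div_iff₀ hD hD']
  nlinarith [mul_pos (mul_pos hS' hσ) (sub_pos.2 hc)]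

theorem stmt0 {N M G : ℕ} (hN : 0 < N) (hM : 0 < M) (hG : 0 < G)
    {U : Type*} [Fintype U] [Nonempty U] (g : U → Fin G)
    (hd : U → EuclideanSpace ℂ (Fin N)) (Gc : U → Matrix (Fin N) (Fin M) ℂ)
    (σ : ℝ) (hσ : 0 < σ ^ 2) (γ : U → ℝ) (hγ : ∀ u, 0 < γ u)
    (P : ℝ) (hP : 0 < P) (tstar Pstar : ℝ) (htstar : 0 < tstar)
    (hGreatest : IsGreatest
      {t : ℝ | ∃ w : Fin G → EuclideanSpace ℂ (Fin N),
        ∃ e : EuclideanSpace ℂ (Fin M), (∀ m, ‖e m‖ = 1) ∧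
          Ptot w ≤ P ∧ t = minW g hd Gc σ γ w e} tstar)
    (hLeast : IsLeast
      {p : ℝ | ∃ w : Fin G → EuclideanSpace ℂ (Fin N),
        ∃ e : EuclideanSpace ℂ (Fin M), (∀ m, ‖e m‖ = 1) ∧
          (∀ u, tstar * γ u ≤ SINR g hd Gc σ w e u) ∧ p = Ptot w} Pstar) :
    Pstar = P := by
  obtain ⟨⟨w, e, he, hw, ht⟩, hmax⟩ := hGreatest
  obtain ⟨⟨w', e', he', hw', hP'⟩, hmin⟩ := hLeast
  apply le_antisymm
  · refine le_trans (hmin ⟨w, e, he, fun u => ?_, rfl⟩) hw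
    rw [← le_div_iff₀ (hγ u), ht]
    exact Finset.inf'_le _ (Finset.mem_univ u)
  · by_contra! hlt
    have h0 : 0 ≤ Pstar := by
      rw [hP']; exact Finset.sum_nonneg fun _ _ => by positivity
    have hr : 0 < (P - Pstar) / (Pstar + 1) := div_pos (by linarith) (by linarith)
    have hr2 : (P - Pstar) / (Pstar + 1) * (Pstar + 1) = P - Pstar :=
      div_mul_cancel₀ _ (by linarith)
    generalize (P - Pstar) / (Pstar + 1) = r at hr hr2
    have hc : Real.sqrt (1 + r) ^ 2 = 1 + r := Real.sq_sqrt (by linarith)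
    generalize Real.sqrt (1 + r) = c at hc
    have hp : Ptot (fun i => (c : ℂ) • w' i) = c ^ 2 * Pstar := by
      rw [hP']; unfold Ptot
      rw [Finset.mul_sum]
      refine Finset.sum_congr rfl fun i _ => ?_
      rw [norm_smul, mul_pow]; simp
    have h1 := hmax ⟨fun i => (c : ℂ) • w' i, e', he', by rw [hp, hc]; nlinarith, rfl⟩
    refine absurd h1 (not_le.2 ?_)
    unfold minW
    rw [Finset.lt_inf'_iff]
    intro u _
    rw [lt_div_iff₀ (hγ u)]
    exact (hw' u).trans_lt (SINR_smul g hd Gc σ hσ w' e' u c (by linarith)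
      ((mul_pos htstar (hγ u)).trans_le (hw' u)))
end

section
/- Let t > 0. Suppose P* is the least element of the set {p ∈ ℝ : ∃ w, ∃ e ∈ T, SINR_u(w,e) ≥ t·γ_u for all u ∈ U and p = P_tot(w)}, and suppose t' is the greatest element of the set {s ∈ ℝ : ∃ w, ∃ e ∈ T, P_tot(w) ≤ P* and s = f(w,e)}. Then t' = t. (This is the identity t = S_o(γ, P_o(t·γ)) of Proposition 1: the RIS-assisted multicast QoS power-minimization problem and the RIS-assisted max-min-fair problem are inverse problems.) -/
theorem aux_SINR_scale {N M G : ℕ} {U : Type*} (g : U → Fin G)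
    (hd : U → EuclideanSpace ℂ (Fin N)) (Gc : U → Matrix (Fin N) (Fin M) ℂ)
    (σ : ℝ) (hσ : 0 < σ ^ 2) (w : Fin G → EuclideanSpace ℂ (Fin N))
    (e : EuclideanSpace ℂ (Fin M)) (u : U) (c : ℝ) (hc1 : c ^ 2 ≤ 1) :
    c ^ 2 * SINR g hd Gc σ w e u ≤ SINR g hd Gc σ (fun i => (c : ℂ) • w i) e u := by
  unfold SINR
  have key : ∀ i, ‖(inner ℂ ((c : ℂ) • w i) (effChan hd Gc u e) : ℂ)‖ ^ 2
      = c ^ 2 * ‖(inner ℂ (w i) (effChan hd Gc u e) : ℂ)‖ ^ 2 := by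
    intro i
    rw [inner_smul_left, norm_mul, mul_pow]
    simp
  simp only [key]
  rw [← Finset.mul_sum, ← mul_div_assoc]
  have hI : 0 ≤ ∑ j ∈ Finset.univ \ {g u}, ‖(inner ℂ (w j) (effChan hd Gc u e) : ℂ)‖ ^ 2 :=
    Finset.sum_nonneg fun _ _ => by positivity
  apply div_le_div_of_nonneg_left
  · positivity
  · have := mul_nonneg (sq_nonneg c) hI
    linarith
  · have := mul_le_mul_of_nonneg_right hc1 hI
    linarith

theorem stmt1 {N M G : ℕ} (hN : 0 < N) (hM : 0 < M) (hG : 0 < G)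
    {U : Type*} [Fintype U] [Nonempty U] (g : U → Fin G)
    (hd : U → EuclideanSpace ℂ (Fin N)) (Gc : U → Matrix (Fin N) (Fin M) ℂ)
    (σ : ℝ) (hσ : 0 < σ ^ 2) (γ : U → ℝ) (hγ : ∀ u, 0 < γ u)
    (t : ℝ) (ht : 0 < t) (Pstar t' : ℝ)
    (hLeast : IsLeast
      {p : ℝ | ∃ w : Fin G → EuclideanSpace ℂ (Fin N),
        ∃ e : EuclideanSpace ℂ (Fin M), (∀ m, ‖e m‖ = 1) ∧
          (∀ u, t * γ u ≤ SINR g hd Gc σ w e u) ∧ p = Ptot w} Pstar)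
    (hGreatest : IsGreatest
      {s : ℝ | ∃ w : Fin G → EuclideanSpace ℂ (Fin N),
        ∃ e : EuclideanSpace ℂ (Fin M), (∀ m, ‖e m‖ = 1) ∧
          Ptot w ≤ Pstar ∧ s = minW g hd Gc σ γ w e} t') :
    t' = t := by
  obtain ⟨⟨w, e, he, hS, hP⟩, hmin⟩ := hLeast
  obtain ⟨⟨w', e', he', hP', ht'⟩, hmax⟩ := hGreatest
  have h1 : t ≤ t' := by
    refine le_trans ?_ (hmax ⟨w, e, he, hP.ge, rfl⟩)
    unfold minW
    rw [Finset.le_inf'_iff]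
    intro u _
    rw [le_div_iff₀ (hγ u)]
    exact hS u
  by_contra hne
  have hlt : t < t' := lt_of_le_of_ne h1 (Ne.symm hne)
  have htp : 0 < t' := ht.trans hlt
  have hS' : ∀ u, t' * γ u ≤ SINR g hd Gc σ w' e' u := by
    intro u
    rw [← le_div_iff₀ (hγ u), ht']
    exact Finset.inf'_le _ (Finset.mem_univ u)
  have hc : (√(t / t')) ^ 2 = t / t' := Real.sq_sqrt (by positivity)
  have hc1 : t / t' < 1 := (div_lt_one htp).2 hlt
  have hpos : 0 < Ptot w' := by
    obtain ⟨u⟩ := ‹Nonempty U›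
    have hw : w' (g u) ≠ 0 := by
      intro h0
      have h := hS' u
      have h2 := mul_pos htp (hγ u)
      have : SINR g hd Gc σ w' e' u = 0 := by simp [SINR, h0]
      linarith
    unfold Ptot
    refine Finset.sum_pos' (fun _ _ => by positivity) ⟨g u, Finset.mem_univ _, ?_⟩
    have := norm_pos_iff.2 hw
    positivity
  have hscale : Ptot (fun i => ((√(t / t') : ℝ) : ℂ) • w' i) = t / t' * Ptot w' := by
    unfold Ptot
    rw [Finset.mul_sum]
    refine Finset.sum_congr rfl fun i _ => ?_
    rw [norm_smul, mul_pow, Complex.norm_real, Real.norm_eq_abs, sq_abs, hc]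
  have hle : Pstar ≤ t / t' * Ptot w' := by
    refine hmin ⟨fun i => ((√(t / t') : ℝ) : ℂ) • w' i, e', he', fun u => ?_, hscale.symm⟩
    refine le_trans ?_ (aux_SINR_scale g hd Gc σ hσ w' e' u _ (hc.le.trans hc1.le))
    rw [hc]
    have := mul_le_mul_of_nonneg_left (hS' u) (by positivity : 0 ≤ t / t')
    have h3 : t / t' * (t' * γ u) = t * γ u := by field_simp
    linarith
  have := mul_lt_mul_of_pos_right hc1 hpos
  linarith
end

section
/- Let P > 0 be a power budget, let e ∈ ℂ^M, and let w : Fin G → ℂ^N satisfy P_tot(w) < P and SINR_u(w,e) > 0 for every user u. Then there exists w' : Fin G → ℂ^N with P_tot(w') ≤ P and min_{u ∈ U} SINR_u(w',e)/γ_u > min_{u ∈ U} SINR_u(w,e)/γ_u. (Unused power budget can always be converted into a strictly larger minimum weighted SINR.) -/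
theorem stmt3 {N M G : ℕ} (hN : 0 < N) (hM : 0 < M) (hG : 0 < G)
    {U : Type*} [Fintype U] [Nonempty U] (g : U → Fin G)
    (hd : U → EuclideanSpace ℂ (Fin N)) (Gc : U → Matrix (Fin N) (Fin M) ℂ)
    (σ : ℝ) (hσ : 0 < σ ^ 2) (γ : U → ℝ) (hγ : ∀ u, 0 < γ u)
    (P : ℝ) (hP : 0 < P) (e : EuclideanSpace ℂ (Fin M))
    (w : Fin G → EuclideanSpace ℂ (Fin N))
    (hpow : Ptot w < P) (hpos : ∀ u : U, 0 < SINR g hd Gc σ w e u) :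
    ∃ w' : Fin G → EuclideanSpace ℂ (Fin N),
      Ptot w' ≤ P ∧ minW g hd Gc σ γ w e < minW g hd Gc σ γ w' e := by
  have hp0 : 0 ≤ Ptot w := Finset.sum_nonneg fun i _ => by positivity
  set t : ℝ := 1 + (P - Ptot w) / P with ht
  have hq : 0 < (P - Ptot w) / P := div_pos (by linarith) hP
  have ht1 : 1 < t := by linarith
  have ht0 : 0 ≤ t := by linarith
  have hs : Real.sqrt t ^ 2 = t := Real.sq_sqrt ht0
  refine ⟨fun i => ((Real.sqrt t : ℝ) : ℂ) • w i, ?_, ?_⟩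
  · have h1 : Ptot (fun i => ((Real.sqrt t : ℝ) : ℂ) • w i) = t * Ptot w := by
      simp only [Ptot, Finset.mul_sum]
      refine Finset.sum_congr rfl fun i _ => ?_
      rw [norm_smul, mul_pow, Complex.norm_real, Real.norm_eq_abs, sq_abs, hs]
    rw [h1]
    have h2 : (P - Ptot w) / P * P = P - Ptot w := div_mul_cancel₀ _ hP.ne'
    have h3 : (P - Ptot w) / P * Ptot w ≤ (P - Ptot w) / P * P :=
      mul_le_mul_of_nonneg_left hpow.le hq.le
    rw [ht, add_mul]
    linarith
  · unfold minW
    rw [Finset.lt_inf'_iff]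
    intro u hu
    refine lt_of_le_of_lt (Finset.inf'_le _ hu) ?_
    refine div_lt_div_of_pos_right ?_ (hγ u)
    have hu0 := hpos u
    have key : ∀ j, ‖(inner ℂ (((Real.sqrt t : ℝ) : ℂ) • w j) (effChan hd Gc u e) : ℂ)‖ ^ 2
        = t * ‖(inner ℂ (w j) (effChan hd Gc u e) : ℂ)‖ ^ 2 := by
      intro j
      rw [inner_smul_left, norm_mul, mul_pow, RCLike.norm_conj, Complex.norm_real,
        Real.norm_eq_abs, sq_abs, hs]
    unfold SINR at hu0 ⊢
    simp only [key]
    rw [← Finset.mul_sum]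
    have hI : 0 ≤ ∑ j ∈ Finset.univ \ {g u},
        ‖(inner ℂ (w j) (effChan hd Gc u e) : ℂ)‖ ^ 2 :=
      Finset.sum_nonneg fun i _ => by positivity
    generalize (∑ j ∈ Finset.univ \ {g u},
        ‖(inner ℂ (w j) (effChan hd Gc u e) : ℂ)‖ ^ 2) = I at *
    generalize ‖(inner ℂ (w (g u)) (effChan hd Gc u e) : ℂ)‖ ^ 2 = S at *
    have hD : 0 < I + σ ^ 2 := by linarith
    have hS : 0 < S := (div_pos_iff_of_pos_right hD).1 hu0
    have hD' : 0 < t * I + σ ^ 2 := by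
      have := mul_nonneg ht0 hI
      linarith
    rw [div_lt_div_iff₀ hD hD']
    have : 0 < S * σ ^ 2 * (t - 1) := mul_pos (mul_pos hS hσ) (by linarith)
    linarith
end

section
/- The feasible sets of problems P_1 and P_2 coincide: {w : Fin G → ℂ^N | ∃ e ∈ T, SINR_u(w,e) ≥ γ_u for all u ∈ U} = {w : Fin G → ℂ^N | 1 ≤ sSup { min_{u ∈ U} SINR_u(w,e)/γ_u : e ∈ T }}, where T = {e ∈ ℂ^M : |e_m| = 1 for all m}. (The joint SINR/unit-modulus constraints on (w,e) are equivalent to the single constraint that the supremum over unit-modulus RIS vectors of the minimum weighted SINR is at least 1.) -/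
theorem continuous_effChan_aux {N M : ℕ} {U : Type*}
    (hd : U → EuclideanSpace ℂ (Fin N)) (Gc : U → Matrix (Fin N) (Fin M) ℂ) (u : U) :
    Continuous (effChan hd Gc u) := by
  unfold effChan
  refine continuous_const.add ?_
  refine (PiLp.continuous_toLp 2 (fun _ : Fin N => ℂ)).comp ?_
  fun_prop

theorem continuous_SINR_aux {N M G : ℕ} {U : Type*} (g : U → Fin G)
    (hd : U → EuclideanSpace ℂ (Fin N)) (Gc : U → Matrix (Fin N) (Fin M) ℂ)
    (σ : ℝ) (hσ : 0 < σ ^ 2) (w : Fin G → EuclideanSpace ℂ (Fin N)) (u : U) :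
    Continuous (fun e => SINR g hd Gc σ w e u) := by
  have h := continuous_effChan_aux hd Gc u
  unfold SINR
  refine Continuous.div (by fun_prop) (by fun_prop) ?_
  intro e
  positivity

theorem isCompact_torus_aux (M : ℕ) :
    IsCompact {e : EuclideanSpace ℂ (Fin M) | ∀ m, ‖e m‖ = 1} := by
  have h : IsCompact (Set.univ.pi fun _ : Fin M => Metric.sphere (0 : ℂ) 1) :=
    isCompact_univ_pi fun _ => isCompact_sphere 0 1
  have h2 := h.image (PiLp.continuous_toLp 2 (fun _ : Fin M => ℂ))
  convert h2 using 1
  ext e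
  simp only [Set.mem_setOf_eq, Set.mem_image, Set.mem_pi, Set.mem_univ, true_imp_iff,
    mem_sphere_zero_iff_norm]
  constructor
  · intro he
    exact ⟨fun m => e m, he, rfl⟩
  · rintro ⟨x, hx, rfl⟩
    exact hx

theorem stmt9 {N M G : ℕ} (hN : 0 < N) (hM : 0 < M) (hG : 0 < G)
    {U : Type*} [Fintype U] [Nonempty U] (g : U → Fin G)
    (hd : U → EuclideanSpace ℂ (Fin N)) (Gc : U → Matrix (Fin N) (Fin M) ℂ)
    (σ : ℝ) (hσ : 0 < σ ^ 2) (γ : U → ℝ) (hγ : ∀ u, 0 < γ u) :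
    {w : Fin G → EuclideanSpace ℂ (Fin N) |
      ∃ e : EuclideanSpace ℂ (Fin M), (∀ m, ‖e m‖ = 1) ∧
        ∀ u : U, γ u ≤ SINR g hd Gc σ w e u} =
    {w : Fin G → EuclideanSpace ℂ (Fin N) |
      1 ≤ sSup ((fun e => minW g hd Gc σ γ w e) ''
        {e : EuclideanSpace ℂ (Fin M) | ∀ m, ‖e m‖ = 1})} := by 
  ext w
  have hcont : Continuous (fun e => minW g hd Gc σ γ w e) := by
    unfold minW
    exact Continuous.finset_inf'_apply Finset.univ_nonempty
      fun u _ => (continuous_SINR_aux g hd Gc σ hσ w u).div_const _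
  have hK := (isCompact_torus_aux M).image hcont
  have key : ∀ e, 1 ≤ minW g hd Gc σ γ w e ↔ ∀ u, γ u ≤ SINR g hd Gc σ w e u := by
    intro e
    simp only [minW, Finset.le_inf'_iff, Finset.mem_univ, true_imp_iff]
    exact forall_congr' fun u => one_le_div (hγ u)
  have hne : {e : EuclideanSpace ℂ (Fin M) | ∀ m, ‖e m‖ = 1}.Nonempty :=
    ⟨WithLp.toLp 2 (fun _ => 1), fun m => by simp⟩
  simp only [Set.mem_setOf_eq]
  constructor
  · rintro ⟨e, he, h⟩
    exact ((key e).2 h).trans (le_csSup hK.bddAbove ⟨e, he, rfl⟩)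
  · intro h
    obtain ⟨e, he, h'⟩ := hK.sSup_mem (hne.image _)
    refine ⟨e, he, (key e).1 ?_⟩
    rw [← h'] at h
    exact h
end
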